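/- Let w ∈ W be in reduced form and satisfy Hypothesis (L). Then there exists k₀ with n+1 ≤ k₀ ≤ r such that w(n) = k₀ or w(n) = k₀'. -/

import Mathlib

/-!  Common framework: Weyl groups of classical groups, modeled as permutations of ℕ
supported on `{1,…,r₀}`, with the convention `i' = r₀ + 1 - i`. -/

/-- `IsWfull r₀ w`: `w` fixes every point outside `{1,…,r₀}` and commutes with the
involution `ι : i ↦ r₀ + 1 - i` on `{1,…,r₀}`.  This is the full group of permutations
of `{1,…,r₀}` commuting with `ι` (the Weyl group of `SO(2r+1)`, `U(2r+1)` or `U(2r)`). -/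
def IsWfull (r₀ : ℕ) (w : Equiv.Perm ℕ) : Prop :=
  (∀ i : ℕ, ¬(1 ≤ i ∧ i ≤ r₀) → w i = i) ∧
  (∀ i : ℕ, 1 ≤ i → i ≤ r₀ → w (r₀ + 1 - i) = r₀ + 1 - w i)

/-- The parity condition singling out the Weyl group of `SO(2r)`:
the number of indices `1 ≤ i ≤ r` with `w i > r` is even. -/
def EvenCond (r : ℕ) (w : Equiv.Perm ℕ) : Prop :=
  Even (((Finset.Icc 1 r).filter (fun i => r < w i)).card)

/-- Membership in `W`; the proposition `so2r` indicates whether we are in the `SO(2r)`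
case (where the parity condition is imposed on top of `IsWfull`). -/
def MemW (r r₀ : ℕ) (so2r : Prop) (w : Equiv.Perm ℕ) : Prop :=
  IsWfull r₀ w ∧ (so2r → EvenCond r w)

/-- Membership in `W_M`: an element of `W` with `w({1,…,n}) = {1,…,n}` and
`w({n+1,…,r₀−n}) = {n+1,…,r₀−n}`. -/
def MemWM (r r₀ n : ℕ) (so2r : Prop) (m : Equiv.Perm ℕ) : Prop :=
  MemW r r₀ so2r m ∧
  (Finset.Icc 1 n).image (fun i => m i) = Finset.Icc 1 n ∧
  (Finset.Icc (n + 1) (r₀ - n)).image (fun i => m i) = Finset.Icc (n + 1) (r₀ - n)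

/-- The left coset `w·{m | P m}`. -/
def coset (P : Equiv.Perm ℕ → Prop) (w : Equiv.Perm ℕ) : Set (Equiv.Perm ℕ) :=
  {x | ∃ m, P m ∧ x = w * m}

/-- `w` is in standard form: a product of pairwise disjoint transpositions
`∏ᵢ (aᵢ aᵢ') · ∏ᵢ (bᵢ cᵢ)(cᵢ' bᵢ')` with `aᵢ, bᵢ ∈ {1,…,n}` and `cᵢ ∈ {n+1,…,r₀−n}`.
This is encoded pointwise: `w` belongs to the full group `W`, is an involution, every
moved point `i ∈ {1,…,n}` has `w i = i'` or `w i ∈ {n+1,…,r₀−n}`, and every moved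
point `i ∈ {n+1,…,r₀−n}` has `w i ∈ {1,…,n}` or `w i ∈ {n',…,r₀}`. -/
def IsStandardForm (r₀ n : ℕ) (w : Equiv.Perm ℕ) : Prop :=
  IsWfull r₀ w ∧ w * w = 1 ∧
  (∀ i, 1 ≤ i → i ≤ n → w i ≠ i →
    (w i = r₀ + 1 - i ∨ (n + 1 ≤ w i ∧ w i ≤ r₀ - n))) ∧
  (∀ i, n + 1 ≤ i → i ≤ r₀ - n → w i ≠ i →
    (w i ≤ n ∨ r₀ + 1 - n ≤ w i))

/-- The 4-cycle `(a b c d)` sending `a ↦ b ↦ c ↦ d ↦ a`. -/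
def cycle4 (a b c d : ℕ) : Equiv.Perm ℕ :=
  Equiv.swap a b * Equiv.swap b c * Equiv.swap c d

/-- `w` is in reduced form: `w = w₁ w₂` with `w₁` in standard form, `w₂` disjoint from
`w₁`, and `w₂` either the identity, or (only in the `SO(2r)` case) a transposition
`(d₀ d₀')` with `n+1 ≤ d₀ ≤ r`, or a 4-cycle `(i₀ j₀' i₀' j₀)` with `1 ≤ i₀ ≤ n < j₀ ≤ r`. -/
def IsReducedForm (r r₀ n : ℕ) (so2r : Prop) (w : Equiv.Perm ℕ) : Prop :=
  ∃ w₁ w₂ : Equiv.Perm ℕ,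
    IsStandardForm r₀ n w₁ ∧ w = w₁ * w₂ ∧ Equiv.Perm.Disjoint w₁ w₂ ∧
    (w₂ = 1 ∨
      (so2r ∧
        ((∃ d₀, n + 1 ≤ d₀ ∧ d₀ ≤ r ∧ w₂ = Equiv.swap d₀ (r₀ + 1 - d₀)) ∨
         (∃ i₀ j₀, 1 ≤ i₀ ∧ i₀ ≤ n ∧ n < j₀ ∧ j₀ ≤ r ∧
            w₂ = cycle4 i₀ (r₀ + 1 - j₀) (r₀ + 1 - i₀) j₀))))

/-- The vector `e_i : {1,…,r₀} → ℤ` with `e_i(i) = 1`, `e_i(i') = −1`, `0` elsewhere. -/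
def evec (r₀ i : ℕ) : ℕ → ℤ :=
  fun k => if k = i then 1 else if k = r₀ + 1 - i then -1 else 0

/-- The simple root `α_i = e_i − e_{i+1}`. -/
def rootAlpha (r₀ i : ℕ) : ℕ → ℤ := evec r₀ i - evec r₀ (i + 1)

/-- The root `β = e_ℓ + e_{ℓ+1}`. -/
def rootBeta (r₀ l : ℕ) : ℕ → ℤ := evec r₀ l + evec r₀ (l + 1)

/-- The action of `w` on root vectors: `(w·v)(k) = v(w⁻¹ k)`. -/
def pact (w : Equiv.Perm ℕ) (v : ℕ → ℤ) : ℕ → ℤ := fun k => v (w⁻¹ k)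

/-- The set `X = {α_1,…,α_ℓ, β}`. -/
def Xset (r₀ l : ℕ) : Set (ℕ → ℤ) :=
  {v | (∃ i, 1 ≤ i ∧ i ≤ l ∧ v = rootAlpha r₀ i) ∨ v = rootBeta r₀ l}

/-- The set of short and long roots `{e_i, 2e_i : 1 ≤ i ≤ n}` from which `S₀` is drawn. -/
def ShortLong (r₀ n : ℕ) : Set (ℕ → ℤ) :=
  {v | ∃ i, 1 ≤ i ∧ i ≤ n ∧ (v = evec r₀ i ∨ v = evec r₀ i + evec r₀ i)}

/-- `Σ_P^+ = {e_i ± e_j : 1 ≤ i ≤ n < j ≤ r} ∪ {e_i + e_j : 1 ≤ i < j ≤ n} ∪ S₀`. -/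
def SigmaP (r r₀ n : ℕ) (S₀ : Set (ℕ → ℤ)) : Set (ℕ → ℤ) :=
  {v | ∃ i j, 1 ≤ i ∧ i ≤ n ∧ n < j ∧ j ≤ r ∧
        (v = evec r₀ i - evec r₀ j ∨ v = evec r₀ i + evec r₀ j)} ∪
  {v | ∃ i j, 1 ≤ i ∧ i < j ∧ j ≤ n ∧ v = evec r₀ i + evec r₀ j} ∪ S₀

/-- Hypothesis (E): `w·α ∉ X` for every `α ∈ Σ_P^+`. -/
def HypE (r r₀ n l : ℕ) (S₀ : Set (ℕ → ℤ)) (w : Equiv.Perm ℕ) : Prop :=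
  ∀ α ∈ SigmaP r r₀ n S₀, pact w α ∉ Xset r₀ l

/-- Hypothesis (L): `α_ℓ = w·α` for some `α ∈ Σ_P^+`; no other element of `X` is of the
form `w·α` with `α ∈ Σ_P^+`; and `w⁻¹·α_ℓ` is not of the form `e_i + e_j` with
`1 ≤ i, j ≤ n`. -/
def HypL (r r₀ n l : ℕ) (S₀ : Set (ℕ → ℤ)) (w : Equiv.Perm ℕ) : Prop :=
  (∃ α ∈ SigmaP r r₀ n S₀, pact w α = rootAlpha r₀ l) ∧
  (∀ α ∈ SigmaP r r₀ n S₀, pact w α ∈ Xset r₀ l → pact w α = rootAlpha r₀ l) ∧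
  ¬ ∃ i j, 1 ≤ i ∧ i ≤ n ∧ 1 ≤ j ∧ j ≤ n ∧
      pact w⁻¹ (rootAlpha r₀ l) = evec r₀ i + evec r₀ j

/-- The permutation `(1 r₀)(2 r₀−1)⋯(n n')`. -/
def w0base (r₀ n : ℕ) : Equiv.Perm ℕ :=
  (((List.range n).map (fun i => Equiv.swap (i + 1) (r₀ - i))).prod)

namespace IsWfull

variable {r₀ : ℕ} {w : Equiv.Perm ℕ}

theorem apply_mem (hw : IsWfull r₀ w) {i : ℕ} (h1 : 1 ≤ i) (h2 : i ≤ r₀) :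
    1 ≤ w i ∧ w i ≤ r₀ := by
  by_contra h
  have := w.injective (hw.1 _ h)
  omega

theorem inv (hw : IsWfull r₀ w) : IsWfull r₀ w⁻¹ := by
  have hout : ∀ i : ℕ, ¬(1 ≤ i ∧ i ≤ r₀) → w⁻¹ i = i := fun i hi => by
    rw [Equiv.Perm.inv_eq_iff_eq, hw.1 i hi]
  refine ⟨hout, fun i h1 h2 => ?_⟩
  have hmem : 1 ≤ w⁻¹ i ∧ w⁻¹ i ≤ r₀ := by
    by_contra h
    have h' := hw.1 _ h
    rw [show w (w⁻¹ i) = i from w.apply_symm_apply i] at h'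
    omega
  rw [Equiv.Perm.inv_eq_iff_eq, hw.2 _ hmem.1 hmem.2, show w (w⁻¹ i) = i from w.apply_symm_apply i]

end IsWfull

theorem pact_evec {r₀ : ℕ} {w : Equiv.Perm ℕ} (hw : IsWfull r₀ w) {i : ℕ}
    (h1 : 1 ≤ i) (h2 : i ≤ r₀) : pact w (evec r₀ i) = evec r₀ (w i) := by
  funext k
  simp only [pact, evec, Equiv.Perm.inv_eq_iff_eq, hw.2 i h1 h2]

theorem pact_sub (w : Equiv.Perm ℕ) (u v : ℕ → ℤ) : pact w (u - v) = pact w u - pact w v := rfl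

theorem pact_add (w : Equiv.Perm ℕ) (u v : ℕ → ℤ) : pact w (u + v) = pact w u + pact w v := rfl

theorem pact_inv_pact (w : Equiv.Perm ℕ) (v : ℕ → ℤ) : pact w⁻¹ (pact w v) = v := by
  funext k
  simp [pact]

theorem evec_reflect {r₀ i : ℕ} (h2 : i ≤ r₀) (hne : 2 * i ≠ r₀ + 1) :
    evec r₀ (r₀ + 1 - i) = -evec r₀ i := by
  funext k
  simp only [evec, Pi.neg_apply]
  split_ifs <;> first | rfl | omega

/-- Elements of `Σ_P^+` are nonnegative on `{1,…,n}` and positive somewhere there. -/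
theorem sigmaP_nonneg_and_pos {r r₀ n : ℕ} {S₀ : Set (ℕ → ℤ)} (hnr : n < r) (hr : 2 * r ≤ r₀)
    (hS₀ : S₀ ⊆ ShortLong r₀ n) {α : ℕ → ℤ} (hα : α ∈ SigmaP r r₀ n S₀) :
    (∀ k, 1 ≤ k → k ≤ n → 0 ≤ α k) ∧ ∃ k, 1 ≤ k ∧ k ≤ n ∧ 0 < α k := by
  have key : ∃ i, 1 ≤ i ∧ i ≤ n ∧ 0 < α i ∧ ∀ k, 1 ≤ k → k ≤ n → 0 ≤ α k := by
    rcases hα with (⟨i, j, h1, h2, h3, h4, rfl | rfl⟩ | ⟨i, j, h1, h2, h3, rfl⟩) | hα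
    case inr =>
      obtain ⟨i, h1, h2, rfl | rfl⟩ := hS₀ hα <;>
      · refine ⟨i, h1, h2, ?_, fun k hk1 hk2 => ?_⟩ <;>
          simp only [evec, Pi.add_apply] <;> split_ifs <;> omega
    all_goals
      refine ⟨i, h1, by omega, ?_, fun k hk1 hk2 => ?_⟩ <;>
        simp only [evec, Pi.add_apply, Pi.sub_apply] <;> split_ifs <;> omega
  obtain ⟨i, h1, h2, h3, h4⟩ := key
  exact ⟨h4, i, h1, h2, h3⟩

theorem evec_sub_mem_sigmaP {r r₀ n : ℕ} (S₀ : Set (ℕ → ℤ)) (hr₀ : r₀ = 2 * r ∨ r₀ = 2 * r + 1)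
    {p q : ℕ} (hp1 : 1 ≤ p) (hpn : p ≤ n) (hnq : n < q) (hqr : q ≤ r₀)
    (hpq : p + q ≠ r₀ + 1) (hq : 2 * q ≠ r₀ + 1) :
    evec r₀ p - evec r₀ q ∈ SigmaP r r₀ n S₀ := by
  by_cases hqr' : q ≤ r
  · exact Or.inl (Or.inl ⟨p, q, hp1, hpn, hnq, hqr', Or.inl rfl⟩)
  have hneg : evec r₀ q = -evec r₀ (r₀ + 1 - q) := by
    rw [evec_reflect hqr hq, neg_neg]
  rw [hneg, sub_neg_eq_add]
  by_cases hqn : r₀ + 1 - q ≤ n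
  · refine Or.inl (Or.inr ?_)
    rcases lt_or_gt_of_ne (show p ≠ r₀ + 1 - q by omega) with h | h
    · exact ⟨p, r₀ + 1 - q, hp1, h, hqn, rfl⟩
    · exact ⟨r₀ + 1 - q, p, by omega, h, hpn, add_comm _ _⟩
  · exact Or.inl (Or.inl ⟨p, r₀ + 1 - q, hp1, hpn, by omega, by omega, Or.inr rfl⟩)

theorem rootAlpha_ne_rootAlpha {r₀ i l : ℕ} (hi : i < l) (hl : 2 * l ≤ r₀) :
    rootAlpha r₀ i ≠ rootAlpha r₀ l := by
  intro h
  have := congrFun h i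
  simp only [rootAlpha, evec, Pi.sub_apply] at this
  split_ifs at this <;> omega

theorem rootBeta_ne_rootAlpha (r₀ l : ℕ) :
    rootBeta r₀ l ≠ rootAlpha r₀ l := by
  intro h
  have := congrFun h (l + 1)
  simp only [rootAlpha, rootBeta, evec, Pi.sub_apply, Pi.add_apply] at this
  split_ifs at this <;> omega

/-- On `{1,…,n}`, an element in reduced form, as well as its inverse, sends `i` to `i`, to `i'`
or into `{n+1,…,r₀−n}`. -/
theorem IsReducedForm.apply_cases {r r₀ n : ℕ} {so2r : Prop} {w : Equiv.Perm ℕ}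
    (hr : 2 * r ≤ r₀) (hnr : n < r) (hred : IsReducedForm r r₀ n so2r w) {i : ℕ}
    (h1 : 1 ≤ i) (h2 : i ≤ n) :
    (w i = i ∨ w i = r₀ + 1 - i ∨ (n + 1 ≤ w i ∧ w i ≤ r₀ - n)) ∧
    (w⁻¹ i = i ∨ w⁻¹ i = r₀ + 1 - i ∨ (n + 1 ≤ w⁻¹ i ∧ w⁻¹ i ≤ r₀ - n)) := by
  obtain ⟨w₁, w₂, ⟨-, hsq, hsmall, -⟩, rfl, hdisj, hw₂⟩ := hred
  have hcomm := hdisj.commute.eq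
  by_cases hfix : w₂ i = i
  · have hw : (w₁ * w₂) i = w₁ i := by rw [Equiv.Perm.mul_apply, hfix]
    have hinv : (w₁ * w₂)⁻¹ i = w₁ i := by
      rw [Equiv.Perm.inv_eq_iff_eq, hcomm, Equiv.Perm.mul_apply, ← Equiv.Perm.mul_apply w₁, hsq,
        Equiv.Perm.one_apply, hfix]
    rw [hw, hinv]
    have := hsmall i h1 h2
    tauto
  · have hfix₁ : w₁ i = i := (hdisj i).resolve_right hfix
    have hw : (w₁ * w₂) i = w₂ i := by rw [hcomm, Equiv.Perm.mul_apply, hfix₁]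
    rcases hw₂ with rfl | ⟨-, ⟨d, hd1, hd2, rfl⟩ | ⟨a, j, ha1, ha2, hj1, hj2, rfl⟩⟩
    · simp at hfix
    · exact absurd (Equiv.swap_apply_of_ne_of_ne (by omega) (by omega)) hfix
    · have hia : i = a := by
        by_contra hia
        apply hfix
        simp only [cycle4, Equiv.Perm.mul_apply]
        rw [Equiv.swap_apply_of_ne_of_ne (a := r₀ + 1 - a) (b := j) (by omega) (by omega),
          Equiv.swap_apply_of_ne_of_ne (a := r₀ + 1 - j) (b := r₀ + 1 - a) (by omega) (by omega),
          Equiv.swap_apply_of_ne_of_ne (by omega) (by omega)]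
      subst hia
      have hi : cycle4 i (r₀ + 1 - j) (r₀ + 1 - i) j i = r₀ + 1 - j := by
        simp only [cycle4, Equiv.Perm.mul_apply]
        rw [Equiv.swap_apply_of_ne_of_ne (a := r₀ + 1 - i) (b := j) (by omega) (by omega),
          Equiv.swap_apply_of_ne_of_ne (a := r₀ + 1 - j) (b := r₀ + 1 - i) (by omega) (by omega),
          Equiv.swap_apply_left]
      have hj : cycle4 i (r₀ + 1 - j) (r₀ + 1 - i) j j = i := by
        simp [cycle4, Equiv.Perm.mul_apply]
      have hinv : (w₁ * cycle4 i (r₀ + 1 - j) (r₀ + 1 - i) j)⁻¹ i = j := by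
        rw [Equiv.Perm.inv_eq_iff_eq, Equiv.Perm.mul_apply, hj, hfix₁]
      rw [hw, hinv, hi]
      omega

/-- if `w ∈ W` is in reduced form and satisfies Hypothesis (L), then
`w n = k₀` or `w n = k₀'` for some `n+1 ≤ k₀ ≤ r`. -/
theorem stmt16 (r n ℓ r₀ : ℕ) (so2r : Prop)
    (hn : 1 ≤ n) (hnl : n ≤ ℓ) (hlr : ℓ + 1 ≤ r)
    (hr₀ : r₀ = 2 * r ∨ r₀ = 2 * r + 1) (hso : so2r → r₀ = 2 * r)
    (S₀ : Set (ℕ → ℤ)) (hS₀ : S₀ ⊆ ShortLong r₀ n)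
    (w : Equiv.Perm ℕ) (hw : MemW r r₀ so2r w)
    (hred : IsReducedForm r r₀ n so2r w)
    (hL : HypL r r₀ n ℓ S₀ w) :
    ∃ k₀, n + 1 ≤ k₀ ∧ k₀ ≤ r ∧ (w n = k₀ ∨ w n = r₀ + 1 - k₀) := by
  have hr : 2 * r ≤ r₀ := by omega
  have hfull := hw.1
  obtain ⟨⟨α, hα, hαw⟩, hX, hno⟩ := hL
  set u := w⁻¹ with hu
  have hufull : IsWfull r₀ u := hfull.inv
  have hwu : ∀ k, w (u k) = k := w.apply_symm_apply
  have hmem : ∀ k, 1 ≤ k → k ≤ r → 1 ≤ u k ∧ u k ≤ r₀ := fun k h1 h2 =>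
    hufull.apply_mem h1 (by omega)
  have hself : ∀ j k, 1 ≤ j → j ≤ r → 1 ≤ k → k ≤ r → u j + u k ≠ r₀ + 1 := by
    intro j k hj1 hj2 hk1 hk2 h
    have h' := hufull.2 k hk1 (by omega)
    have := u.injective (show u j = u (r₀ + 1 - k) by omega)
    omega
  have hpact : ∀ k, 1 ≤ k → k ≤ r → pact w (evec r₀ (u k)) = evec r₀ k := by
    intro k h1 h2
    rw [pact_evec hfull (hmem k h1 h2).1 (hmem k h1 h2).2, hwu]
  have hsub : ∀ k, 1 ≤ k → k < ℓ → evec r₀ (u k) - evec r₀ (u (k + 1)) ∉ SigmaP r r₀ n S₀ := by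
    intro k h1 h2 hk
    have hroot : pact w (evec r₀ (u k) - evec r₀ (u (k + 1))) = rootAlpha r₀ k := by
      rw [pact_sub, hpact k h1 (by omega), hpact (k + 1) (by omega) (by omega), rootAlpha]
    have := hX _ hk (hroot ▸ Or.inl ⟨k, h1, h2.le, rfl⟩)
    exact rootAlpha_ne_rootAlpha h2 (by omega) (hroot.symm.trans this)
  have hbeta : evec r₀ (u ℓ) + evec r₀ (u (ℓ + 1)) ∉ SigmaP r r₀ n S₀ := by
    intro hk
    have hroot : pact w (evec r₀ (u ℓ) + evec r₀ (u (ℓ + 1))) = rootBeta r₀ ℓ := by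
      rw [pact_add, hpact ℓ (by omega) (by omega), hpact (ℓ + 1) (by omega) (by omega), rootBeta]
    have := hX _ hk (hroot ▸ Or.inr rfl)
    exact rootBeta_ne_rootAlpha r₀ ℓ (hroot.symm.trans this)
  have hpull : pact u (rootAlpha r₀ ℓ) = evec r₀ (u ℓ) - evec r₀ (u (ℓ + 1)) := by
    rw [rootAlpha, pact_sub, pact_evec hufull (by omega) (by omega),
      pact_evec hufull (by omega) (by omega)]
  have hαeq : α = evec r₀ (u ℓ) - evec r₀ (u (ℓ + 1)) := by
    rw [← hpull, ← hαw, pact_inv_pact]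
  obtain ⟨hnonneg, k₁, hk₁1, hk₁2, hpos⟩ := sigmaP_nonneg_and_pos (by omega) hr hS₀ hα
  have hcases := fun i h1 h2 => hred.apply_cases hr (by omega) (i := i) h1 h2
  have hℓ := hmem ℓ (by omega) (by omega)
  have hℓ' := hmem (ℓ + 1) (by omega) (by omega)
  have hℓne := hself ℓ (ℓ + 1) (by omega) (by omega) (by omega) (by omega)
  have hℓmid := hself (ℓ + 1) (ℓ + 1) (by omega) (by omega) (by omega) (by omega)
  have hℓinj : u ℓ ≠ u (ℓ + 1) := fun h => by have := u.injective h; omega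
  by_cases hfix : u n = n
  · exfalso
    have hsmall : ∀ k, n ≤ k → k ≤ ℓ → u k ≤ n := by
      intro k hk
      induction k, hk using Nat.le_induction with
      | base => omega
      | succ k hk ih =>
        intro hkl
        by_contra hlarge
        have hm := hmem k (by omega) (by omega)
        have hm' := hmem (k + 1) (by omega) (by omega)
        have hne := hself (k + 1) (k + 1) (by omega) (by omega) (by omega) (by omega)
        exact hsub k (by omega) (by omega)
          (evec_sub_mem_sigmaP S₀ hr₀ hm.1 (ih (by omega)) (by omega) hm'.2
            (hself _ _ (by omega) (by omega) (by omega) (by omega)) (by omega))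
    have hp := hsmall ℓ hnl le_rfl
    have hq : n < u (ℓ + 1) := by
      by_contra hq
      have := hnonneg (u (ℓ + 1)) hℓ'.1 (by omega)
      rw [hαeq] at this
      simp only [evec, Pi.sub_apply] at this
      split_ifs at this <;> omega
    have hneg : evec r₀ (r₀ + 1 - u (ℓ + 1)) = -evec r₀ (u (ℓ + 1)) :=
      evec_reflect hℓ'.2 (by omega)
    by_cases hq' : r₀ + 1 - u (ℓ + 1) ≤ n
    · refine hno ⟨u ℓ, r₀ + 1 - u (ℓ + 1), hℓ.1, hp, by omega, hq', ?_⟩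
      rw [hpull, hneg, sub_eq_add_neg]
    · have := evec_sub_mem_sigmaP (p := u ℓ) (q := r₀ + 1 - u (ℓ + 1)) S₀ hr₀ hℓ.1 hp
        (by omega) (by omega) (by omega) (by omega)
      rw [hneg, sub_neg_eq_add] at this
      exact hbeta this
  by_cases hflip : u n = r₀ + 1 - n
  · exfalso
    have hall : ∀ m, m < n → u (n - m) = r₀ + 1 - (n - m) := by
      intro m
      induction m with
      | zero => exact fun _ => hflip
      | succ m ih =>
        intro hm
        have hi := ih (by omega)
        obtain ⟨i, hi'⟩ : ∃ i, n - (m + 1) = i := ⟨_, rfl⟩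
        rw [show n - m = i + 1 by omega] at hi
        rw [hi']
        by_contra hne
        have hci := (hcases i (by omega) (by omega)).2
        rw [← hu] at hci
        have hm' := hmem i (by omega) (by omega)
        have hs := hself i i (by omega) (by omega) (by omega) (by omega)
        have hmem' := evec_sub_mem_sigmaP (p := i + 1) (q := r₀ + 1 - u i) (n := n) S₀ hr₀
          (by omega) (by omega) (by omega) (by omega) (by omega) (by omega)
        refine hsub i (by omega) (by omega) ?_
        rw [hi, evec_reflect (i := i + 1) (by omega) (by omega), sub_neg_eq_add, add_comm]
        rwa [evec_reflect hm'.2 (by omega), sub_neg_eq_add] at hmem'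
    have hall' : ∀ i, 1 ≤ i → i ≤ n → u i = r₀ + 1 - i := fun i h1 h2 => by
      have := hall (n - i) (by omega)
      rwa [show n - (n - i) = i by omega] at this
    have hmid : ∀ k, n < k → k ≤ r → n < u k ∧ u k ≤ r₀ - n := by
      intro k hk1 hk2
      have hm := hmem k (by omega) hk2
      constructor
      · by_contra h
        have h1 := hall' (u k) hm.1 (by omega)
        have h2 := hufull.2 (u k) hm.1 hm.2
        rw [h1] at h2
        have := u.injective (show u (r₀ + 1 - u k) = u k by omega)
        have := hself k k (by omega) hk2 (by omega) hk2
        omega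
      · by_contra h
        have h1 := hall' (r₀ + 1 - u k) (by omega) (by omega)
        have := u.injective (show u (r₀ + 1 - u k) = u k by omega)
        have := hself k k (by omega) hk2 (by omega) hk2
        omega
    have hq := hmid (ℓ + 1) (by omega) (by omega)
    rcases hnl.eq_or_lt with rfl | hlt
    · rw [hαeq] at hpos
      simp only [evec, Pi.sub_apply] at hpos
      split_ifs at hpos <;> omega
    · have hp := hmid ℓ hlt (by omega)
      rw [hαeq] at hpos
      simp only [evec, Pi.sub_apply] at hpos
      split_ifs at hpos <;> omega
  have hwn : n + 1 ≤ w n ∧ w n ≤ r₀ - n := by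
    rcases (hcases n hn le_rfl).1 with h | h | h
    · exact absurd ((Equiv.Perm.inv_eq_iff_eq).2 h.symm) hfix
    · have h' := hfull.2 n hn (by omega)
      exact absurd ((Equiv.Perm.inv_eq_iff_eq).2 (show n = w (r₀ + 1 - n) by omega)) hflip
    · exact h
  by_cases hle : w n ≤ r
  · exact ⟨w n, hwn.1, hle, Or.inl rfl⟩
  · have hne : w n ≠ r₀ + 1 - w n := fun h => by
      have := w.injective (h.trans (hfull.2 n hn (by omega)).symm)
      omega
    exact ⟨r₀ + 1 - w n, by omega, by omega, Or.inr (by omega)⟩
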